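/- arXiv:2605.28927 — 3 statements merged into one kernel-verified Lean document; each statement's English description precedes it below -/
import Mathlib

section
/- For every m ≥ 1, the (m+1)×(m+1) real matrix R_m defined in the context is orthogonal: R_mᵀ · R_m equals the (m+1)×(m+1) identity matrix. -/
open Matrix

/-- The rotation matrix `R_m` (indices `0, …, m`; the "last" index of the context,
`m+1`, corresponds to `m` here). -/
noncomputable def Rmat (m : ℕ) : Matrix (Fin (m + 1)) (Fin (m + 1)) ℝ :=
  Matrix.of fun i j =>
    if (j : ℕ) = m then 1 / Real.sqrt (m + 1)
    else if (i : ℕ) = m then -1 / Real.sqrt (m + 1)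
    else if i = j then (1 + ((m : ℝ) - 1) * Real.sqrt (m + 1)) / (m * Real.sqrt (m + 1))
    else (1 - Real.sqrt (m + 1)) / (m * Real.sqrt (m + 1))

theorem Rmat_last_right (m : ℕ) (i : Fin (m + 1)) :
    Rmat m i (Fin.last m) = 1 / Real.sqrt (m + 1) := by
  simp [Rmat]

theorem Rmat_last_castSucc (m : ℕ) (j : Fin m) :
    Rmat m (Fin.last m) j.castSucc = -1 / Real.sqrt (m + 1) := by
  simp [Rmat, j.isLt.ne]

/-- The upper-left block of `R_m` is the identity plus a constant matrix. -/
theorem Rmat_castSucc_castSucc (m : ℕ) (i j : Fin m) :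
    Rmat m i.castSucc j.castSucc =
      (if i = j then 1 else 0) + (1 - Real.sqrt (m + 1)) / (m * Real.sqrt (m + 1)) := by
  have hm : (m : ℝ) ≠ 0 := Nat.cast_ne_zero.mpr (i.pos).ne'
  have hs : Real.sqrt ((m : ℝ) + 1) ≠ 0 := by positivity
  by_cases h : i = j
  · simp only [Rmat, of_apply, Fin.val_castSucc, j.isLt.ne, h, if_true, if_false]
    field_simp
    ring
  · simp [Rmat, i.isLt.ne, j.isLt.ne, h]

theorem Rmat_orthogonal (m : ℕ) (hm : 1 ≤ m) :
    (Rmat m)ᵀ * Rmat m = 1 := by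
  have hm0 : (m : ℝ) ≠ 0 := by positivity
  have hs : Real.sqrt ((m : ℝ) + 1) ≠ 0 := by positivity
  have hsq : Real.sqrt ((m : ℝ) + 1) ^ 2 = m + 1 := Real.sq_sqrt (by positivity)
  ext i j
  rw [mul_apply, Fin.sum_univ_castSucc]
  simp only [transpose_apply]
  induction i using Fin.lastCases with
  | last =>
    induction j using Fin.lastCases with
    | last =>
      simp only [Rmat_last_right, Finset.sum_const, Finset.card_univ, Fintype.card_fin,
        nsmul_eq_mul, one_apply_eq]
      field_simp
      linarith
    | cast j =>
      rw [one_apply_ne (Fin.castSucc_ne_last j).symm]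
      simp only [Rmat_last_right, Rmat_last_castSucc, Rmat_castSucc_castSucc, mul_add,
        Finset.sum_add_distrib, Finset.sum_const, Finset.card_univ, Fintype.card_fin,
        nsmul_eq_mul, mul_ite, mul_one, mul_zero, Finset.sum_ite_eq', Finset.mem_univ, if_true]
      field_simp
      ring
  | cast i =>
    induction j using Fin.lastCases with
    | last =>
      rw [one_apply_ne (Fin.castSucc_ne_last i)]
      simp only [Rmat_last_right, Rmat_last_castSucc, Rmat_castSucc_castSucc, add_mul,
        Finset.sum_add_distrib, Finset.sum_const, Finset.card_univ, Fintype.card_fin,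
        nsmul_eq_mul, ite_mul, one_mul, zero_mul, Finset.sum_ite_eq', Finset.mem_univ, if_true]
      field_simp
      ring
    | cast j =>
      simp only [Rmat_last_castSucc, Rmat_castSucc_castSucc, add_mul, mul_add,
        Finset.sum_add_distrib, Finset.sum_const, Finset.card_univ, Fintype.card_fin,
        nsmul_eq_mul, ite_mul, mul_ite, one_mul, mul_one, zero_mul, mul_zero,
        Finset.sum_ite_eq', Finset.mem_univ, if_true, one_apply, Fin.castSucc_inj,
        eq_comm (a := j) (b := i)]
      rw [add_assoc, add_assoc, add_eq_left]
      field_simp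
      linear_combination -hsq
end

section
/- (Schoenberg's theorem.) Let n ≥ 1, let d be a metric on the finite set {1, ..., n}, let D^{(2)} be the n×n matrix with entries D^{(2)}_{ij} = d(i, j)², let C = I_n − (1/n)·𝟙𝟙ᵀ be the centering matrix, and set G = −(1/2)·C·D^{(2)}·C. Then there exist k ∈ ℕ and points y_1, ..., y_n ∈ ℝ^k with ‖y_i − y_j‖ = d(i, j) for all i, j if and only if G is positive semidefinite; moreover, when G is positive semidefinite, the smallest such k equals the rank of G. -/
/-- Entries of a doubly centered matrix. -/
theorem centering_mul_mul_centering_apply {n : ℕ} (M : Matrix (Fin n) (Fin n) ℝ) (i j : Fin n) :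
    ((1 - (n : ℝ)⁻¹ • Matrix.of (fun _ _ => (1 : ℝ))) * M *
      (1 - (n : ℝ)⁻¹ • Matrix.of (fun _ _ => (1 : ℝ))) : Matrix (Fin n) (Fin n) ℝ) i j =
      M i j - (n : ℝ)⁻¹ * ∑ l, M l j - (n : ℝ)⁻¹ * ∑ l, M i l +
        (n : ℝ)⁻¹ * ((n : ℝ)⁻¹ * ∑ l, ∑ m, M m l) := by
  rw [Matrix.mul_sub, Matrix.sub_mul, Matrix.sub_mul]
  simp only [Matrix.smul_mul, Matrix.mul_smul, Matrix.sub_apply, Matrix.smul_apply,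
    Matrix.mul_apply, Matrix.of_apply, one_mul, mul_one, smul_eq_mul, Finset.sum_sub_distrib,
    ← Finset.mul_sum]
  ring

/-- Double centering turns squared distances into the Gram matrix of the centered points. -/
theorem centering_sq_dist_eq_gram {n k : ℕ} (hn : n ≠ 0) (y : Fin n → EuclideanSpace ℝ (Fin k)) :
    (-(1 / 2) : ℝ) • ((1 - (n : ℝ)⁻¹ • Matrix.of (fun _ _ => (1 : ℝ))) *
      Matrix.of (fun i j => ‖y i - y j‖ ^ 2) *
      (1 - (n : ℝ)⁻¹ • Matrix.of (fun _ _ => (1 : ℝ)))) =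
      Matrix.gram ℝ (fun i => y i - (n : ℝ)⁻¹ • ∑ l, y l) := by
  have hn' : (n : ℝ) ≠ 0 := Nat.cast_ne_zero.mpr hn
  ext i j
  rw [Matrix.smul_apply, centering_mul_mul_centering_apply, Matrix.gram_apply]
  simp only [Matrix.of_apply, norm_sub_sq_real, Finset.sum_add_distrib, Finset.sum_sub_distrib,
    Finset.sum_const, Finset.card_univ, Fintype.card_fin, nsmul_eq_mul, smul_eq_mul,
    ← Finset.mul_sum, ← inner_sum, ← sum_inner, inner_sub_left, inner_sub_right,
    real_inner_smul_left, real_inner_smul_right]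
  field_simp
  ring

theorem rank_gram_eq_finrank_span {n k : ℕ} (v : Fin n → EuclideanSpace ℝ (Fin k)) :
    (Matrix.gram ℝ v).rank = Module.finrank ℝ (Submodule.span ℝ (Set.range v)) := by
  rw [Matrix.gram_eq_conjTranspose_mul (EuclideanSpace.basisFun (Fin k) ℝ),
    Matrix.rank_conjTranspose_mul_self, Matrix.rank_eq_finrank_span_cols]
  rw [← LinearEquiv.finrank_map_eq (WithLp.linearEquiv 2 ℝ (Fin k → ℝ)), Submodule.map_span,
    ← Set.range_comp]
  rfl

open scoped MatrixOrder in
/-- A positive semidefinite matrix is a Gram matrix of vectors in dimension equal to its rank. -/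
theorem Matrix.PosSemidef.exists_gram_eq_of_rank {n : ℕ} {G : Matrix (Fin n) (Fin n) ℝ}
    (hG : G.PosSemidef) :
    ∃ y : Fin n → EuclideanSpace ℝ (Fin G.rank), Matrix.gram ℝ y = G := by
  obtain ⟨B, hB⟩ := CStarAlgebra.nonneg_iff_eq_star_mul_self.mp hG.nonneg
  let v : Fin n → EuclideanSpace ℝ (Fin n) := fun j => WithLp.toLp 2 (B.col j)
  have hv : Matrix.gram ℝ v = G := by
    rw [Matrix.gram_eq_conjTranspose_mul (EuclideanSpace.basisFun (Fin n) ℝ), hB]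
    rfl
  have hr : Module.finrank ℝ (Submodule.span ℝ (Set.range v)) = G.rank := by
    rw [← rank_gram_eq_finrank_span, hv]
  let e := ((stdOrthonormalBasis ℝ (Submodule.span ℝ (Set.range v))).reindex (finCongr hr)).repr
  refine ⟨fun i => e ⟨v i, Submodule.subset_span (Set.mem_range_self i)⟩, ?_⟩
  ext i j
  refine Eq.trans ?_ (congrFun₂ hv i j)
  rw [Matrix.gram_apply, Matrix.gram_apply, LinearIsometryEquiv.inner_map_map,
    Submodule.coe_inner]

theorem schoenberg (n : ℕ) (hn : 1 ≤ n) (d : Fin n → Fin n → ℝ)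
    (hd0 : ∀ i j, d i j = 0 ↔ i = j)
    (hdsymm : ∀ i j, d i j = d j i)
    (hdtri : ∀ i j k, d i j ≤ d i k + d k j)
    (C D2 G : Matrix (Fin n) (Fin n) ℝ)
    (hC : C = 1 - (n : ℝ)⁻¹ • Matrix.of (fun _ _ => (1 : ℝ)))
    (hD2 : D2 = Matrix.of fun i j => d i j ^ 2)
    (hG : G = (-(1 / 2) : ℝ) • (C * D2 * C)) :
    -- an isometric Euclidean embedding exists iff `G` is positive semidefinite …
    ((∃ k : ℕ, ∃ y : Fin n → EuclideanSpace ℝ (Fin k),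
        ∀ i j, ‖y i - y j‖ = d i j) ↔ G.PosSemidef) ∧
    -- … and then the smallest possible embedding dimension is the rank of `G`
    (G.PosSemidef →
      IsLeast {k : ℕ | ∃ y : Fin n → EuclideanSpace ℝ (Fin k),
        ∀ i j, ‖y i - y j‖ = d i j} G.rank) := by
  have gram_of_embedding {k : ℕ} (y : Fin n → EuclideanSpace ℝ (Fin k))
      (hy : ∀ i j, ‖y i - y j‖ = d i j) :
      G = Matrix.gram ℝ (fun i => y i - (n : ℝ)⁻¹ • ∑ l, y l) := by
    rw [← centering_sq_dist_eq_gram (by lia), hG, hC, hD2]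
    simp only [hy]
  have d_nonneg (i j : Fin n) : 0 ≤ d i j := by
    have h := hdtri i i j
    rw [(hd0 i i).mpr rfl, ← hdsymm i j] at h
    linarith
  have sq_dist_eq (i j : Fin n) : G i i - 2 * G i j + G j j = d i j ^ 2 := by
    have row_eq_col (k : Fin n) : ∑ l, d k l ^ 2 = ∑ l, d l k ^ 2 := by
      simp only [hdsymm k]
    have diag (k : Fin n) : d k k = 0 := (hd0 k k).mpr rfl
    simp only [hG, hC, hD2, Matrix.smul_apply, centering_mul_mul_centering_apply,
      Matrix.of_apply, smul_eq_mul, row_eq_col, diag]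
    ring
  have embedding_of_posSemidef (h : G.PosSemidef) :
      ∃ y : Fin n → EuclideanSpace ℝ (Fin G.rank), ∀ i j, ‖y i - y j‖ = d i j := by
    obtain ⟨y, hy⟩ := h.exists_gram_eq_of_rank
    refine ⟨y, fun i j => ?_⟩
    rw [← sq_eq_sq₀ (norm_nonneg _) (d_nonneg i j), norm_sub_sq_real, ← sq_dist_eq i j,
      ← real_inner_self_eq_norm_sq, ← real_inner_self_eq_norm_sq]
    simp only [← Matrix.gram_apply, hy]
  refine ⟨⟨?_, fun h => ⟨_, embedding_of_posSemidef h⟩⟩,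
    fun h => ⟨embedding_of_posSemidef h, ?_⟩⟩
  · rintro ⟨k, y, hy⟩
    rw [gram_of_embedding y hy]
    exact Matrix.posSemidef_gram ..
  · rintro k ⟨y, hy⟩
    rw [gram_of_embedding y hy, rank_gram_eq_finrank_span]
    exact (Submodule.finrank_le _).trans_eq finrank_euclideanSpace_fin
end

section
/- Let G be a real symmetric n×n matrix with spectral decomposition G = Σ_i λ_i·u_i u_iᵀ (u_i an orthonormal eigenbasis), and let G⁺ = Σ_i max(λ_i, 0)·u_i u_iᵀ be its positive part. Then G⁺ is the unique minimizer of the Frobenius distance to G among positive semidefinite matrices: for every positive semidefinite real symmetric n×n matrix M, ‖M − G‖_F ≥ ‖G⁺ − G‖_F, with equality if and only if M = G⁺. -/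
open Matrix

theorem trace_transpose_mul_vecMulVec_self {n : Type*} [Fintype n]
    (A : Matrix n n ℝ) (v : n → ℝ) :
    (Aᵀ * vecMulVec v v).trace = v ⬝ᵥ A *ᵥ v := by
  rw [mul_vecMulVec, trace_vecMulVec, mulVec_transpose, ← dotProduct_mulVec]

theorem dotProduct_sum_smul_vecMulVec_mulVec {ι n : Type*} [Fintype ι] [DecidableEq ι] [Fintype n]
    (u : ι → n → ℝ) (hu : ∀ i j, u i ⬝ᵥ u j = if i = j then (1 : ℝ) else 0)
    (c : ι → ℝ) (i : ι) :
    u i ⬝ᵥ (∑ j, c j • vecMulVec (u j) (u j)) *ᵥ u i = c i := by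
  simp [sum_mulVec, smul_mulVec, vecMulVec_mulVec, hu]

theorem trace_transpose_mul_self_add {n : Type*} [Fintype n] (A B : Matrix n n ℝ) :
    ((A + B)ᵀ * (A + B)).trace =
      (Aᵀ * A).trace + 2 * (Aᵀ * B).trace + (Bᵀ * B).trace := by
  have h : (Bᵀ * A).trace = (Aᵀ * B).trace := by
    rw [← trace_transpose, transpose_mul, transpose_transpose]
  simp only [transpose_add, add_mul, mul_add, trace_add, h]
  ring

/-- The displacement from the positive part to a positive semidefinite matrix makes a
nonnegative Frobenius inner product with the displacement from `G` to its positive part. -/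
theorem trace_transpose_sub_positive_part_mul_nonneg {ι n : Type*}
    [Fintype ι] [DecidableEq ι] [Fintype n] (lam : ι → ℝ) (u : ι → n → ℝ)
    (hu : ∀ i j, u i ⬝ᵥ u j = if i = j then (1 : ℝ) else 0)
    {M : Matrix n n ℝ} (hM : M.PosSemidef) :
    0 ≤ ((M - ∑ i, max (lam i) 0 • vecMulVec (u i) (u i))ᵀ *
      (∑ i, max (lam i) 0 • vecMulVec (u i) (u i) -
        ∑ i, lam i • vecMulVec (u i) (u i))).trace := by
  rw [← Finset.sum_sub_distrib, Finset.mul_sum, trace_sum]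
  refine Finset.sum_nonneg fun i _ => ?_
  rw [← sub_smul, mul_smul_comm, trace_smul, trace_transpose_mul_vecMulVec_self, sub_mulVec,
    dotProduct_sub, dotProduct_sum_smul_vecMulVec_mulVec u hu, smul_eq_mul]
  have h : 0 ≤ u i ⬝ᵥ M *ᵥ u i := by simpa using hM.dotProduct_mulVec_nonneg (u i)
  rcases le_total (lam i) 0 with hi | hi
  · rw [max_eq_right hi]
    nlinarith
  · simp [max_eq_left hi]

theorem positive_part_closest_psd_matrix
    (n : ℕ) (lam : Fin n → ℝ) (u : Fin n → (Fin n → ℝ))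
    (hu : ∀ i j, u i ⬝ᵥ u j = if i = j then (1 : ℝ) else 0)
    (G Gplus : Matrix (Fin n) (Fin n) ℝ)
    (hG : G = ∑ i, lam i • Matrix.vecMulVec (u i) (u i))
    (hGplus : Gplus = ∑ i, max (lam i) 0 • Matrix.vecMulVec (u i) (u i)) :
    ∀ M : Matrix (Fin n) (Fin n) ℝ, M.PosSemidef →
      Real.sqrt (((Gplus - G)ᵀ * (Gplus - G)).trace) ≤
        Real.sqrt (((M - G)ᵀ * (M - G)).trace) ∧
      (Real.sqrt (((M - G)ᵀ * (M - G)).trace) =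
        Real.sqrt (((Gplus - G)ᵀ * (Gplus - G)).trace) ↔ M = Gplus) := by
  intro M hM
  have hcross := trace_transpose_sub_positive_part_mul_nonneg lam u hu hM
  rw [← hG, ← hGplus] at hcross
  have hexpand := trace_transpose_mul_self_add (M - Gplus) (Gplus - G)
  rw [sub_add_sub_cancel] at hexpand
  have hnonneg (A : Matrix (Fin n) (Fin n) ℝ) : 0 ≤ (Aᵀ * A).trace := by
    simpa using (posSemidef_conjTranspose_mul_self A).trace_nonneg
  have hA := hnonneg (M - Gplus)
  refine ⟨Real.sqrt_le_sqrt (by linarith), fun h => ?_, fun h => by rw [h]⟩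
  rw [Real.sqrt_inj (hnonneg _) (hnonneg _)] at h
  have hzero : ((M - Gplus)ᵀ * (M - Gplus)).trace = 0 := by linarith
  rw [← conjTranspose_eq_transpose_of_trivial, trace_conjTranspose_mul_self_eq_zero_iff] at hzero
  exact sub_eq_zero.mp hzero
end
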